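/- arXiv:quant-ph/0301072 — 2 statements merged into one kernel-verified Lean document; each statement's English description precedes it below -/
import Mathlib

section
/- For the 'tagged' state τ = Σ_t p_t |Φ_t⟩⟨Φ_t| ⊗ |t⟩⟨t| on (ℂ^{d}⊗ℂ^{d}) ⊗ ℂ^T, where {|t⟩} is an orthonormal basis of ℂ^T and each Φ_t is a unit vector, the entanglement of formation with respect to the A|BC split (first factor ℂ^d versus the rest) equals Σ_t p_t E(Φ_t), where E(Φ_t) is the entanglement entropy of Φ_t. -/
open scoped BigOperators Classical ComplexOrder

/-- Rank-one projector `|v⟩⟨v|`. -/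
noncomputable def outer {ι : Type*} (v : ι → ℂ) : Matrix ι ι ℂ :=
  fun i j => v i * (starRingEnd ℂ) (v j)

/-- Reduced density matrix of a pure bipartite vector, tracing out the first factor. -/
noncomputable def redMat {α β : Type*} [Fintype α] (ψ : α × β → ℂ) : Matrix β β ℂ :=
  fun i j => ∑ a, ψ (a, i) * (starRingEnd ℂ) (ψ (a, j))

/-- Von Neumann entropy (Shannon entropy of the eigenvalues) of a Hermitian matrix. -/
noncomputable def vnEntropy {ι : Type*} [Fintype ι] [DecidableEq ι]
    (ρ : Matrix ι ι ℂ) : ℝ :=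
  if h : ρ.IsHermitian then -∑ i, h.eigenvalues i * Real.log (h.eigenvalues i) else 0

/-- Entanglement entropy of a pure bipartite state. -/
noncomputable def entE {α β : Type*} [Fintype α] [Fintype β] [DecidableEq β]
    (ψ : α × β → ℂ) : ℝ :=
  vnEntropy (redMat ψ)

/-- Entanglement of formation: infimum of average pure-state entanglement over
finite pure-state decompositions. -/
noncomputable def Ef {α β : Type*} [Fintype α] [Fintype β] [DecidableEq α] [DecidableEq β]
    (ρ : Matrix (α × β) (α × β) ℂ) : ℝ :=
  sInf {x | ∃ (m : ℕ) (q : Fin m → ℝ) (ψ : Fin m → α × β → ℂ),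
    (∀ i, 0 ≤ q i) ∧ (∀ i, ∑ p, ‖ψ i p‖ ^ 2 = 1) ∧
    ρ = ∑ i, ((q i : ℝ) : ℂ) • outer (ψ i) ∧
    x = ∑ i, q i * entE (ψ i)}

open Matrix in
theorem vnEntropy_eq_sum_negMulLog {ι : Type*} [Fintype ι] [DecidableEq ι]
    {A : Matrix ι ι ℂ} (hA : A.IsHermitian) :
    vnEntropy A = ∑ i, Real.negMulLog (hA.eigenvalues i) := by
  simp [vnEntropy, hA, Real.negMulLog, Finset.sum_neg_distrib]

open Matrix Polynomial in
/-- `N * Nᴴ` and `Nᴴ * N` have the same nonzero spectrum, hence the same entropy. -/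
theorem vnEntropy_mul_conjTranspose_comm {m n : Type*} [Fintype m] [Fintype n]
    [DecidableEq m] [DecidableEq n] (N : Matrix m n ℂ) :
    vnEntropy (N * Nᴴ) = vnEntropy (Nᴴ * N) := by
  have h₁ := isHermitian_mul_conjTranspose_self N
  have h₂ := isHermitian_conjTranspose_mul_self N
  have key := congrArg (fun P : ℂ[X] =>
    (P.roots.map fun z => Real.negMulLog z.re).sum) (charpoly_mul_comm' N Nᴴ)
  have hne₁ : (X ^ Fintype.card n * (N * Nᴴ).charpoly : ℂ[X]) ≠ 0 :=
    mul_ne_zero (pow_ne_zero _ X_ne_zero) (charpoly_monic _).ne_zero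
  have hne₂ : (X ^ Fintype.card m * (Nᴴ * N).charpoly : ℂ[X]) ≠ 0 :=
    mul_ne_zero (pow_ne_zero _ X_ne_zero) (charpoly_monic _).ne_zero
  simp only [roots_mul hne₁, roots_mul hne₂, roots_X_pow, h₁.roots_charpoly_eq_eigenvalues,
    h₂.roots_charpoly_eq_eigenvalues] at key
  rw [vnEntropy_eq_sum_negMulLog h₁, vnEntropy_eq_sum_negMulLog h₂]
  simp only [Multiset.map_add, Multiset.sum_add, Multiset.map_nsmul, Multiset.sum_nsmul,
    Multiset.map_singleton, Multiset.sum_singleton, Complex.zero_re, Real.negMulLog_zero,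
    smul_zero, zero_add, Multiset.map_map] at key
  exact key

theorem sum_normSq_row_of_mem_unitaryGroup {ι : Type*} [Fintype ι] [DecidableEq ι]
    {W : Matrix ι ι ℂ} (hW : W ∈ Matrix.unitaryGroup ι ℂ) (k : ι) :
    ∑ j, Complex.normSq (W k j) = 1 := by
  have h := congrFun (congrFun (Matrix.mem_unitaryGroup_iff.mp hW) k) k
  simp only [Matrix.mul_apply, Matrix.star_apply, RCLike.star_def, Complex.mul_conj,
    Matrix.one_apply_eq] at h
  exact_mod_cast h

theorem sum_normSq_col_of_mem_unitaryGroup {ι : Type*} [Fintype ι] [DecidableEq ι]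
    {W : Matrix ι ι ℂ} (hW : W ∈ Matrix.unitaryGroup ι ℂ) (j : ι) :
    ∑ k, Complex.normSq (W k j) = 1 := by
  have h := sum_normSq_row_of_mem_unitaryGroup (Unitary.star_mem hW) j
  simpa [Matrix.star_apply] using h

open Matrix in
/-- The entropy is at most the Shannon entropy of the diagonal in any orthonormal basis. -/
theorem vnEntropy_le_sum_negMulLog_diag {ι : Type*} [Fintype ι] [DecidableEq ι]
    {A : Matrix ι ι ℂ} (hA : A.PosSemidef) {U : Matrix ι ι ℂ} (hU : U ∈ unitaryGroup ι ℂ) :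
    vnEntropy A ≤ ∑ k, Real.negMulLog ((star U * A * U) k k).re := by
  set lam := hA.1.eigenvalues
  set W : Matrix ι ι ℂ := star U * (hA.1.eigenvectorUnitary : Matrix ι ι ℂ)
  have hW : W ∈ unitaryGroup ι ℂ := mul_mem (Unitary.star_mem hU) hA.1.eigenvectorUnitary.2
  have hdiag : ∀ k, ((star U * A * U) k k).re = ∑ j, Complex.normSq (W k j) • lam j := by
    intro k
    have h : star U * A * U = W * diagonal (RCLike.ofReal ∘ lam) * star W := by
      conv_lhs => rw [hA.1.spectral_theorem, Unitary.conjStarAlgAut_apply]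
      simp only [W, star_mul, star_star, Matrix.mul_assoc]
      rfl
    rw [h, Matrix.mul_apply, Complex.re_sum]
    refine Finset.sum_congr rfl fun j _ => ?_
    rw [mul_diagonal, star_apply, Complex.normSq_apply]
    simp
    ring
  rw [vnEntropy_eq_sum_negMulLog hA.1]
  calc ∑ j, Real.negMulLog (lam j)
      = ∑ j, (∑ k, Complex.normSq (W k j)) * Real.negMulLog (lam j) := by
        simp [sum_normSq_col_of_mem_unitaryGroup hW]
    _ = ∑ k, ∑ j, Complex.normSq (W k j) • Real.negMulLog (lam j) := by
        simp only [Finset.sum_mul, smul_eq_mul]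
        exact Finset.sum_comm
    _ ≤ _ := by
        refine Finset.sum_le_sum fun k _ => ?_
        rw [hdiag]
        exact Real.concaveOn_negMulLog.le_map_sum (fun j _ => Complex.normSq_nonneg _)
          (sum_normSq_row_of_mem_unitaryGroup hW k) fun j _ => hA.eigenvalues_nonneg j

open Matrix in
/-- Concavity of the von Neumann entropy. -/
theorem sum_mul_vnEntropy_le {ι κ : Type*} [Fintype ι] [DecidableEq ι] [Fintype κ]
    {A : κ → Matrix ι ι ℂ} (hA : ∀ t, (A t).PosSemidef) {w : κ → ℝ} (hw : ∀ t, 0 ≤ w t)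
    (hw1 : ∑ t, w t = 1) :
    ∑ t, w t * vnEntropy (A t) ≤ vnEntropy (∑ t, ((w t : ℝ) : ℂ) • A t) := by
  set B : Matrix ι ι ℂ := ∑ t, ((w t : ℝ) : ℂ) • A t
  have hB : B.IsHermitian :=
    (posSemidef_sum _ fun t _ => (hA t).smul (by exact_mod_cast hw t)).1
  set U := hB.eigenvectorUnitary
  have hdiag : ∀ k, hB.eigenvalues k =
      ∑ t, w t • ((star (U : Matrix ι ι ℂ) * A t * (U : Matrix ι ι ℂ)) k k).re := by
    intro k
    have h := congrFun (congrFun hB.conjStarAlgAut_star_eigenvectorUnitary k) k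
    rw [Unitary.conjStarAlgAut_star_apply, diagonal_apply_eq] at h
    have h' := congrArg Complex.re h
    simp only [Function.comp_apply] at h'
    rw [show ((RCLike.ofReal (hB.eigenvalues k) : ℂ)).re = hB.eigenvalues k from
      Complex.ofReal_re _] at h'
    rw [← h']
    simp only [B, Matrix.mul_sum, Matrix.sum_mul, Matrix.mul_smul, Matrix.smul_mul,
      Matrix.sum_apply, Matrix.smul_apply, Complex.re_sum, smul_eq_mul, Complex.re_ofReal_mul]
    rfl
  have hpos : ∀ t k, 0 ≤ ((star (U : Matrix ι ι ℂ) * A t * (U : Matrix ι ι ℂ)) k k).re :=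
    fun t k => (Complex.nonneg_iff.mp
      ((hA t).conjTranspose_mul_mul_same (U : Matrix ι ι ℂ)).diag_nonneg).1
  rw [vnEntropy_eq_sum_negMulLog hB]
  calc ∑ t, w t * vnEntropy (A t)
      ≤ ∑ t, w t * ∑ k, Real.negMulLog
          ((star (U : Matrix ι ι ℂ) * A t * (U : Matrix ι ι ℂ)) k k).re :=
        Finset.sum_le_sum fun t _ => mul_le_mul_of_nonneg_left
          (vnEntropy_le_sum_negMulLog_diag (hA t) U.2) (hw t)
    _ = ∑ k, ∑ t, w t • Real.negMulLog
          ((star (U : Matrix ι ι ℂ) * A t * (U : Matrix ι ι ℂ)) k k).re := by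
        simp only [Finset.mul_sum, smul_eq_mul]
        exact Finset.sum_comm
    _ ≤ _ := by
        refine Finset.sum_le_sum fun k _ => ?_
        rw [hdiag]
        exact Real.concaveOn_negMulLog.le_map_sum (fun t _ => hw t) hw1 fun t _ => hpos t k

/-- Transpose of the reduced density matrix obtained by tracing out the second factor. -/
noncomputable def redMatFst {α β : Type*} [Fintype β] (ψ : α × β → ℂ) : Matrix α α ℂ :=
  fun a a' => ∑ b, (starRingEnd ℂ) (ψ (a, b)) * ψ (a', b)

open Matrix in
theorem redMatFst_eq {α β : Type*} [Fintype β] (ψ : α × β → ℂ) :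
    redMatFst ψ = (of fun b a => ψ (a, b))ᴴ * of fun b a => ψ (a, b) := by
  ext a a'
  simp [redMatFst, Matrix.mul_apply]

theorem posSemidef_redMatFst {α β : Type*} [Finite α] [Fintype β] (ψ : α × β → ℂ) :
    (redMatFst ψ).PosSemidef := by
  rw [redMatFst_eq]
  exact Matrix.posSemidef_conjTranspose_mul_self _

open Matrix in
theorem entE_eq_vnEntropy_redMatFst {α β : Type*} [Fintype α] [Fintype β] [DecidableEq α]
    [DecidableEq β] (ψ : α × β → ℂ) : entE ψ = vnEntropy (redMatFst ψ) := by
  have h : redMat ψ = (of fun b a => ψ (a, b)) * (of fun b a => ψ (a, b))ᴴ := by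
    ext i j
    simp [redMat, Matrix.mul_apply]
  rw [entE, h, vnEntropy_mul_conjTranspose_comm, redMatFst_eq]

section RankOne

variable {κ ι : Type*} [Fintype κ] [Fintype ι] {q : κ → ℝ} {χ : κ → ι → ℂ} {p : ℝ} {φ : ι → ℂ}

theorem sum_mul_normSq_overlap (h : ∀ x y, ∑ i, (q i : ℂ) * (χ i x * (starRingEnd ℂ) (χ i y)) =
      (p : ℂ) * (φ x * (starRingEnd ℂ) (φ y))) (u : ι → ℂ) :
    ∑ i, q i * Complex.normSq (∑ x, (starRingEnd ℂ) (u x) * χ i x) =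
      p * Complex.normSq (∑ x, (starRingEnd ℂ) (u x) * φ x) := by
  have expand : ∀ v : ι → ℂ, ((Complex.normSq (∑ x, (starRingEnd ℂ) (u x) * v x) : ℝ) : ℂ) =
      ∑ x, ∑ y, (starRingEnd ℂ) (u x) * u y * (v x * (starRingEnd ℂ) (v y)) := by
    intro v
    rw [← Complex.mul_conj, map_sum, Finset.sum_mul_sum]
    refine Finset.sum_congr rfl fun x _ => Finset.sum_congr rfl fun y _ => ?_
    simp only [map_mul, Complex.conj_conj]
    ring
  have hC : ((∑ i, q i * Complex.normSq (∑ x, (starRingEnd ℂ) (u x) * χ i x) : ℝ) : ℂ) =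
      ((p * Complex.normSq (∑ x, (starRingEnd ℂ) (u x) * φ x) : ℝ) : ℂ) := by
    push_cast
    simp only [expand, Finset.mul_sum]
    rw [Finset.sum_comm]
    refine Finset.sum_congr rfl fun x _ => ?_
    rw [Finset.sum_comm]
    refine Finset.sum_congr rfl fun y _ => ?_
    rw [mul_left_comm, ← h x y, Finset.mul_sum]
    exact Finset.sum_congr rfl fun i _ => by ring
  exact_mod_cast hC

theorem sum_conj_mul_self (hφ : ∑ x, ‖φ x‖ ^ 2 = 1) :
    ∑ x, (starRingEnd ℂ) (φ x) * φ x = 1 := by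
  simp only [← Complex.normSq_eq_conj_mul_self, Complex.normSq_eq_norm_sq]
  exact_mod_cast hφ

/-- The vectors of a decomposition of a rank-one operator are multiples of its range vector. -/
theorem eq_overlap_mul (hq : ∀ i, 0 ≤ q i) (hφ : ∑ x, ‖φ x‖ ^ 2 = 1)
    (h : ∀ x y, ∑ i, (q i : ℂ) * (χ i x * (starRingEnd ℂ) (χ i y)) =
      (p : ℂ) * (φ x * (starRingEnd ℂ) (φ y))) {i : κ} (hi : q i ≠ 0) (x : ι) :
    χ i x = (∑ y, (starRingEnd ℂ) (φ y) * χ i y) * φ x := by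
  set c := ∑ y, (starRingEnd ℂ) (φ y) * χ i y with hc
  set u : ι → ℂ := fun y => χ i y - c * φ y with hu
  have hφ' := sum_conj_mul_self hφ
  have huφ : ∑ y, (starRingEnd ℂ) (u y) * φ y = 0 := by
    have h1 : ∑ y, (starRingEnd ℂ) (χ i y) * φ y = (starRingEnd ℂ) c := by
      rw [hc, map_sum]
      exact Finset.sum_congr rfl fun y _ => by simp [mul_comm]
    simp only [hu, map_sub, map_mul, sub_mul, Finset.sum_sub_distrib, mul_assoc,
      ← Finset.mul_sum, h1, hφ', mul_one, sub_self]
  have hsum := sum_mul_normSq_overlap h u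
  rw [huφ, map_zero, mul_zero, Finset.sum_eq_zero_iff_of_nonneg fun j _ =>
    mul_nonneg (hq j) (Complex.normSq_nonneg _)] at hsum
  have huχ : ∑ y, (starRingEnd ℂ) (u y) * χ i y = 0 :=
    Complex.normSq_eq_zero.mp ((mul_eq_zero.mp (hsum i (Finset.mem_univ i))).resolve_left hi)
  have huu : ∑ y, (starRingEnd ℂ) (u y) * u y = 0 := by
    have : ∀ y, (starRingEnd ℂ) (u y) * u y =
        (starRingEnd ℂ) (u y) * χ i y - c * ((starRingEnd ℂ) (u y) * φ y) := fun y => by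
      simp only [hu]
      ring
    simp only [this, Finset.sum_sub_distrib, ← Finset.mul_sum, huχ, huφ, mul_zero, sub_zero]
  simp only [← Complex.normSq_eq_conj_mul_self] at huu
  have huu' : ∑ y, Complex.normSq (u y) = 0 := by exact_mod_cast huu
  rw [Finset.sum_eq_zero_iff_of_nonneg fun j _ => Complex.normSq_nonneg _] at huu'
  exact sub_eq_zero.mp (Complex.normSq_eq_zero.mp (huu' x (Finset.mem_univ x)))

end RankOne

section Tagged

variable {α β τ : Type*} [Fintype β] [Fintype τ]

theorem sum_normSq_of_tagged [Fintype α] {Φ : τ → α × β → ℂ} (hΦ : ∀ t, ∑ x, ‖Φ t x‖ ^ 2 = 1)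
    {ψ : α × (β × τ) → ℂ} {c : τ → ℂ} (hψ : ∀ a b t, ψ (a, (b, t)) = c t * Φ t (a, b)) :
    ∑ x, ‖ψ x‖ ^ 2 = ∑ t, Complex.normSq (c t) := by
  calc ∑ x, ‖ψ x‖ ^ 2 = ∑ a, ∑ b, ∑ t, ‖c t * Φ t (a, b)‖ ^ 2 := by
        simp only [Fintype.sum_prod_type, hψ]
    _ = ∑ t, ∑ a, ∑ b, Complex.normSq (c t) * ‖Φ t (a, b)‖ ^ 2 := by
        simp only [norm_mul, mul_pow, Complex.normSq_eq_norm_sq]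
        symm
        rw [Finset.sum_comm]
        exact Finset.sum_congr rfl fun a _ => Finset.sum_comm
    _ = ∑ t, Complex.normSq (c t) := by
        refine Finset.sum_congr rfl fun t _ => ?_
        simp only [← Finset.mul_sum]
        rw [← Fintype.sum_prod_type (f := fun x => ‖Φ t x‖ ^ 2), hΦ, mul_one]

theorem redMatFst_of_tagged {Φ : τ → α × β → ℂ} {ψ : α × (β × τ) → ℂ} {c : τ → ℂ}
    (hψ : ∀ a b t, ψ (a, (b, t)) = c t * Φ t (a, b)) :
    redMatFst ψ = ∑ t, ((Complex.normSq (c t) : ℝ) : ℂ) • redMatFst (Φ t) := by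
  ext a a'
  simp only [redMatFst, Fintype.sum_prod_type, hψ, Matrix.sum_apply, Matrix.smul_apply,
    smul_eq_mul, Finset.mul_sum]
  rw [Finset.sum_comm]
  refine Finset.sum_congr rfl fun t _ => Finset.sum_congr rfl fun b _ => ?_
  rw [Complex.normSq_eq_conj_mul_self, map_mul]
  ring

theorem sum_mul_entE_le_of_tagged [Fintype α] [DecidableEq α] [DecidableEq β]
    [DecidableEq τ] {Φ : τ → α × β → ℂ} (hΦ : ∀ t, ∑ x, ‖Φ t x‖ ^ 2 = 1)
    {ψ : α × (β × τ) → ℂ} (hψ1 : ∑ x, ‖ψ x‖ ^ 2 = 1) {c : τ → ℂ}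
    (hψ : ∀ a b t, ψ (a, (b, t)) = c t * Φ t (a, b)) :
    ∑ t, Complex.normSq (c t) * entE (Φ t) ≤ entE ψ := by
  simp only [entE_eq_vnEntropy_redMatFst]
  rw [redMatFst_of_tagged hψ]
  exact sum_mul_vnEntropy_le (fun t => posSemidef_redMatFst _)
    (fun t => Complex.normSq_nonneg _) (by rw [← sum_normSq_of_tagged hΦ hψ, hψ1])

theorem entE_tagged [Fintype α] [DecidableEq α] [DecidableEq β]
    [DecidableEq τ] (Φ : τ → α × β → ℂ) (t : τ) :
    entE (fun q : α × (β × τ) => Φ t (q.1, q.2.1) * (if q.2.2 = t then 1 else 0)) =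
      entE (Φ t) := by
  simp only [entE_eq_vnEntropy_redMatFst]
  rw [redMatFst_of_tagged (Φ := Φ) (c := fun s => if s = t then 1 else 0)]
  · simp [apply_ite Complex.normSq, ite_smul]
  · intro a b s
    by_cases hs : s = t <;> simp [hs]

end Tagged

theorem Ef_tagged_state (d T : ℕ) (p : Fin T → ℝ)
    (hp : ∀ t, 0 ≤ p t) (hp1 : ∑ t, p t = 1)
    (Φ : Fin T → Fin d × Fin d → ℂ) (hΦ : ∀ t, ∑ q, ‖Φ t q‖ ^ 2 = 1) :
    Ef (∑ t, ((p t : ℝ) : ℂ) •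
        outer (fun q : Fin d × (Fin d × Fin T) =>
          Φ t (q.1, q.2.1) * (if q.2.2 = t then 1 else 0))) =
      ∑ t, p t * entE (Φ t) := by
  refine IsLeast.csInf_eq ⟨⟨T, p, _, hp, fun t => ?_, rfl, ?_⟩, ?_⟩
  · rw [sum_normSq_of_tagged hΦ (c := fun s => if s = t then 1 else 0)]
    · simp [apply_ite Complex.normSq]
    · intro a b s
      by_cases hs : s = t <;> simp [hs]
  · exact Finset.sum_congr rfl fun t _ => by rw [entE_tagged]
  · rintro _ ⟨m, q, ψ, hq, hψ, hρ, rfl⟩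
    have hblock : ∀ t (x y : Fin d × Fin d),
        ∑ i, (q i : ℂ) * (ψ i (x.1, (x.2, t)) * (starRingEnd ℂ) (ψ i (y.1, (y.2, t)))) =
          (p t : ℂ) * (Φ t x * (starRingEnd ℂ) (Φ t y)) := by
      intro t x y
      have h := congrFun (congrFun hρ (x.1, (x.2, t))) (y.1, (y.2, t))
      simpa [Matrix.sum_apply, outer] using h.symm
    set c : Fin m → Fin T → ℂ := fun i t =>
      ∑ y : Fin d × Fin d, (starRingEnd ℂ) (Φ t y) * ψ i (y.1, (y.2, t)) with hc
    have hweight : ∀ t, ∑ i, q i * Complex.normSq (c i t) = p t := fun t => by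
      have h := sum_mul_normSq_overlap (hblock t) (Φ t)
      rwa [sum_conj_mul_self (hΦ t), map_one, mul_one] at h
    calc ∑ t, p t * entE (Φ t)
        = ∑ i, q i * ∑ t, Complex.normSq (c i t) * entE (Φ t) := by
          simp only [← hweight, Finset.sum_mul, Finset.mul_sum, mul_assoc]
          exact Finset.sum_comm
      _ ≤ ∑ i, q i * entE (ψ i) := by
          refine Finset.sum_le_sum fun i _ => ?_
          rcases eq_or_ne (q i) 0 with hi | hi
          · simp [hi]
          · exact mul_le_mul_of_nonneg_left (sum_mul_entE_le_of_tagged hΦ (hψ i)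
              fun a b t => eq_overlap_mul hq (hΦ t) (hblock t) hi (a, b)) (hq i)
end

section
/- If d is prime, then every unit vector c ∈ ℂ^d achieving equality S({|c_l|²}) + S({|ĉ_k|²}) = log d in the entropic uncertainty relation satisfies either |supp(c)| = 1 or |supp(ĉ)| = 1; consequently the corresponding state ρ_λ with λ_l = |c_l|² is either a pure maximally entangled state mixture's trivial case (λ a point mass) or the uniform mixture λ_l ≡ 1/d. -/
open scoped BigOperators Classical

/-- The primitive `d`-th root of unity `η = e^{2πi/d}`. -/
noncomputable def eta (d : ℕ) : ℂ := Complex.exp (2 * (Real.pi : ℂ) * Complex.I / d)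

/-- Discrete Fourier transform: `ĉ_k = (1/√d) Σ_l η^{kl} c_l`. -/
noncomputable def dft (d : ℕ) (c : Fin d → ℂ) : Fin d → ℂ := fun k =>
  (1 / (Real.sqrt d : ℂ)) * ∑ l : Fin d, eta d ^ ((k : ℕ) * (l : ℕ)) * c l

/-- Number of nonzero components of a vector. -/
noncomputable def suppCard (d : ℕ) (c : Fin d → ℂ) : ℕ :=
  (Finset.univ.filter fun l => c l ≠ 0).card


/-- Shannon entropy of a probability vector. -/
noncomputable def shannonEntropy (d : ℕ) (p : Fin d → ℝ) : ℝ :=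
  -∑ i, p i * Real.log (p i)

/-- `a / |a| * |a| ^ z`, which is `0` when `a = 0`. -/
noncomputable def polarPow (a z : ℂ) : ℂ := a / ‖a‖ * Complex.exp (z * Real.log ‖a‖)

lemma polarPow_one (a : ℂ) : polarPow a 1 = a := by
  rcases eq_or_ne a 0 with rfl | ha
  · simp [polarPow]
  · have h : 0 < ‖a‖ := norm_pos_iff.2 ha
    have h' : (‖a‖ : ℂ) ≠ 0 := by exact_mod_cast h.ne'
    rw [polarPow, one_mul, ← Complex.ofReal_exp, Real.exp_log h, div_mul_cancel₀ _ h']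

lemma polarPow_two (a : ℂ) : polarPow a 2 = a * ‖a‖ := by
  rcases eq_or_ne a 0 with rfl | ha
  · simp [polarPow]
  · have h : 0 < ‖a‖ := norm_pos_iff.2 ha
    have h' : (‖a‖ : ℂ) ≠ 0 := by exact_mod_cast h.ne'
    rw [polarPow, two_mul, Complex.exp_add, ← Complex.ofReal_exp, Real.exp_log h]
    field_simp

lemma norm_polarPow (a z : ℂ) : ‖polarPow a z‖ = ‖polarPow a z.re‖ := by
  simp [polarPow, Complex.norm_exp]

lemma norm_polarPow_of_re_eq_one (a : ℂ) {z : ℂ} (hz : z.re = 1) : ‖polarPow a z‖ = ‖a‖ := by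
  rw [norm_polarPow, hz, Complex.ofReal_one, polarPow_one]

lemma norm_polarPow_of_re_eq_two (a : ℂ) {z : ℂ} (hz : z.re = 2) :
    ‖polarPow a z‖ = ‖a‖ ^ 2 := by
  rw [norm_polarPow, hz, Complex.ofReal_ofNat, polarPow_two]
  simp [sq]

lemma norm_polarPow_le_one {a z : ℂ} (ha : ‖a‖ ≤ 1) (hz : 0 ≤ z.re) : ‖polarPow a z‖ ≤ 1 := by
  have h : (z * Real.log ‖a‖).re ≤ 0 := by
    rw [Complex.re_mul_ofReal]
    exact mul_nonpos_of_nonneg_of_nonpos hz (Real.log_nonpos (norm_nonneg a) ha)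
  rw [polarPow, norm_mul, Complex.norm_exp, norm_div, Complex.norm_real, norm_norm]
  exact mul_le_one₀ (div_self_le_one _) (Real.exp_pos _).le (Real.exp_le_one_iff.2 h)

lemma hasDerivAt_polarPow (a z : ℂ) :
    HasDerivAt (polarPow a) (Real.log ‖a‖ * polarPow a z) z := by
  have h := (((hasDerivAt_id z).mul_const (Real.log ‖a‖ : ℂ)).cexp).const_mul (a / ‖a‖)
  refine h.congr_deriv ?_
  simp only [polarPow, id]
  ring

/-- If an entire function is bounded by `1` on the strip `0 ≤ re z ≤ 1`, attains `1` at `0` and has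
a critical point there, then it is constant. -/
lemma eq_one_of_norm_le_one_of_deriv_eq_zero {f : ℂ → ℂ} (hf : Differentiable ℂ f)
    (hb : ∀ z : ℂ, 0 ≤ z.re → z.re ≤ 1 → ‖f z‖ ≤ 1) (h0 : f 0 = 1) (h1 : deriv f 0 = 0) (z : ℂ) :
    f z = 1 := by
  have hfa : AnalyticOnNhd ℂ f Set.univ := fun z _ => hf.analyticAt z
  have hga : AnalyticAt ℂ (fun z => f z - 1) 0 := (hf.analyticAt 0).sub analyticAt_const
  by_cases hev : ∀ᶠ z in nhds (0 : ℂ), f z - 1 = 0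
  · have hE : f =ᶠ[nhds 0] fun _ => 1 := hev.mono fun z hz => sub_eq_zero.1 hz
    exact congrFun (hfa.eq_of_eventuallyEq analyticOnNhd_const hE) z
  · exfalso
    obtain ⟨n, h, hh, hne, hE⟩ := hga.exists_eventuallyEq_pow_smul_nonzero_iff.2 hev
    simp only [sub_zero, smul_eq_mul] at hE
    have hn : 2 ≤ n := by
      by_contra! hlt
      interval_cases n
      · have := hE.self_of_nhds
        simp [h0] at this
        exact hne this.symm
      · have hE' : f =ᶠ[nhds 0] fun z => z ^ 1 * h z + 1 :=
          hE.mono fun z hz => eq_add_of_sub_eq hz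
        have hd := (((hasDerivAt_id (0 : ℂ)).mul hh.differentiableAt.hasDerivAt).add_const 1)
        have hd' : HasDerivAt f (h 0) 0 := by
          refine (hd.congr_deriv (by simp)).congr_of_eventuallyEq ?_
          simpa using hE'
        exact hne (hd'.deriv.symm.trans h1)
    set θ : ℝ := -(3 / 4) * (h 0).arg / n with hθ
    have hn0 : (n : ℝ) ≠ 0 := by positivity
    have hn2 : (2 : ℝ) ≤ n := by exact_mod_cast hn
    have hπ := Real.pi_pos
    have harg := Complex.abs_arg_le_pi (h 0)
    have hθπ : |θ| < Real.pi / 2 := by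
      rw [hθ, abs_div, abs_mul, Nat.abs_cast, div_lt_iff₀ (by positivity)]
      norm_num
      nlinarith
    set w : ℂ := Complex.exp (θ * Complex.I) with hw
    have hwre : 0 < w.re := by
      rw [hw, Complex.exp_ofReal_mul_I_re]
      exact Real.cos_pos_of_mem_Ioo ⟨by linarith [(abs_lt.1 hθπ).1], (abs_lt.1 hθπ).2⟩
    have hpos : 0 < (w ^ n * h 0).re := by
      have e : w ^ n * h 0 = ‖h 0‖ * Complex.exp (((h 0).arg / 4 : ℝ) * Complex.I) := by
        conv_lhs => rw [← Complex.norm_mul_exp_arg_mul_I (h 0)]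
        rw [hw, ← Complex.exp_nat_mul, mul_left_comm, ← Complex.exp_add, hθ]
        congr 2
        have : (n : ℂ) ≠ 0 := by exact_mod_cast hn0
        push_cast
        field_simp
        ring
      rw [e, Complex.re_ofReal_mul, Complex.exp_ofReal_mul_I_re]
      refine mul_pos (norm_pos_iff.2 hne) (Real.cos_pos_of_mem_Ioo ?_)
      constructor <;> linarith [(abs_le.1 harg).1, (abs_le.1 harg).2]
    have hlim : Filter.Tendsto (fun t : ℝ => (t : ℂ) * w) (nhdsWithin 0 (Set.Ioi 0)) (nhds 0) := by
      have : Continuous fun t : ℝ => (t : ℂ) * w := by fun_prop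
      simpa using (this.tendsto 0).mono_left nhdsWithin_le_nhds
    have hlimre : Filter.Tendsto (fun t : ℝ => (w ^ n * h (t * w)).re)
        (nhdsWithin 0 (Set.Ioi 0)) (nhds (w ^ n * h 0).re) :=
      (Complex.continuous_re.tendsto _).comp
        ((hh.continuousAt.tendsto.comp hlim).const_mul (w ^ n))
    have hsmall : ∀ᶠ t : ℝ in nhdsWithin 0 (Set.Ioi 0), ((t : ℂ) * w).re < 1 :=
      ((Complex.continuous_re.tendsto _).comp hlim).eventually_lt_const (by simp)
    obtain ⟨t, ht, ht1, htE, htpos⟩ := ((hlimre.eventually_const_lt hpos).and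
      (hsmall.and ((hlim.eventually hE).and self_mem_nhdsWithin))).exists
    have htpos : 0 < t := htpos
    have hre : (f (t * w)).re = 1 + t ^ n * (w ^ n * h (t * w)).re := by
      have : f (t * w) = 1 + ((t ^ n : ℝ) : ℂ) * (w ^ n * h (t * w)) := by
        rw [eq_add_of_sub_eq htE]; push_cast; ring
      rw [this, Complex.add_re, Complex.re_ofReal_mul, Complex.one_re]
    have hle := (Complex.re_le_norm _).trans (hb (t * w)
      (by rw [Complex.re_ofReal_mul]; positivity) ht1.le)
    have : 0 < t ^ n * (w ^ n * h (t * w)).re := by positivity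
    linarith

lemma norm_eta (d : ℕ) : ‖eta d‖ = 1 := by
  have : eta d = Complex.exp ((2 * Real.pi / d : ℝ) * Complex.I) := by
    rw [eta]; congr 1; push_cast; ring
  rw [this, Complex.norm_exp_ofReal_mul_I]

lemma sum_eta_pow_mul_conj {d : ℕ} (hd : d ≠ 0) (l m : Fin d) :
    ∑ k : Fin d, eta d ^ ((k : ℕ) * (l : ℕ)) *
      (starRingEnd ℂ) (eta d ^ ((k : ℕ) * (m : ℕ))) = if l = m then (d : ℂ) else 0 := by
  have hprim : IsPrimitiveRoot (eta d) d := Complex.isPrimitiveRoot_exp d hd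
  have hinv (j : ℕ) : eta d ^ j * (starRingEnd ℂ) (eta d ^ j) = 1 := by
    rw [Complex.mul_conj, Complex.normSq_eq_norm_sq, norm_pow, norm_eta]; simp
  set ζ := eta d ^ (l : ℕ) * (starRingEnd ℂ) (eta d ^ (m : ℕ)) with hζ
  have hsum : ∑ k : Fin d, eta d ^ ((k : ℕ) * (l : ℕ)) *
      (starRingEnd ℂ) (eta d ^ ((k : ℕ) * (m : ℕ))) = ∑ k ∈ Finset.range d, ζ ^ k := by
    rw [← Fin.sum_univ_eq_sum_range]
    refine Finset.sum_congr rfl fun k _ => ?_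
    rw [hζ, mul_pow, ← map_pow, ← pow_mul, ← pow_mul, mul_comm (l : ℕ), mul_comm (m : ℕ)]
  rw [hsum]
  split_ifs with h
  · subst h
    rw [hζ, hinv]
    simp
  · have hζ1 : ζ ≠ 1 := by
      intro h1
      refine h (Fin.ext (hprim.pow_inj l.2 m.2 ?_))
      calc eta d ^ (l : ℕ) = ζ * eta d ^ (m : ℕ) := by
            rw [hζ, mul_assoc, mul_comm ((starRingEnd ℂ) _), hinv, mul_one]
        _ = _ := by rw [h1, one_mul]
    have hζd : ζ ^ d = 1 := by
      rw [hζ, mul_pow, ← map_pow, ← pow_mul, ← pow_mul, mul_comm (l : ℕ), mul_comm (m : ℕ),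
        pow_mul, pow_mul, hprim.pow_eq_one]
      simp
    rw [geom_sum_eq hζ1, hζd, sub_self, zero_div]

/-- The kernel of the discrete Fourier transform. -/
noncomputable def dftKernel (d : ℕ) (k l : Fin d) : ℂ :=
  1 / (Real.sqrt d : ℂ) * eta d ^ ((k : ℕ) * (l : ℕ))

lemma dft_eq_sum (d : ℕ) (c : Fin d → ℂ) (k : Fin d) :
    dft d c k = ∑ l, dftKernel d k l * c l := by
  simp only [dft, dftKernel, Finset.mul_sum, mul_assoc]

lemma norm_dftKernel (d : ℕ) (k l : Fin d) : ‖dftKernel d k l‖ = 1 / Real.sqrt d := by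
  simp [dftKernel, norm_eta, abs_of_nonneg (Real.sqrt_nonneg _)]

lemma sum_dftKernel_mul_conj {d : ℕ} (hd : d ≠ 0) (l m : Fin d) :
    ∑ k, dftKernel d k l * (starRingEnd ℂ) (dftKernel d k m) = if l = m then 1 else 0 := by
  have hs : (Real.sqrt d : ℂ) * Real.sqrt d = d := by
    rw [← Complex.ofReal_mul, Real.mul_self_sqrt (Nat.cast_nonneg d), Complex.ofReal_natCast]
  have hd' : (d : ℂ) ≠ 0 := by exact_mod_cast hd
  have : ∀ k, dftKernel d k l * (starRingEnd ℂ) (dftKernel d k m) =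
      (1 / d : ℂ) * (eta d ^ ((k : ℕ) * (l : ℕ)) *
      (starRingEnd ℂ) (eta d ^ ((k : ℕ) * (m : ℕ)))) := by
    intro k
    rw [dftKernel, dftKernel, map_mul, map_div₀, map_one, Complex.conj_ofReal, ← hs]
    ring
  rw [Finset.sum_congr rfl fun k _ => this k, ← Finset.mul_sum, sum_eta_pow_mul_conj hd]
  split_ifs <;> simp [hd']

lemma sum_conj_dft_mul_dftKernel {d : ℕ} (hd : d ≠ 0) (c : Fin d → ℂ) (l : Fin d) :
    ∑ k, (starRingEnd ℂ) (dft d c k) * dftKernel d k l = (starRingEnd ℂ) (c l) := by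
  have : ∀ k, (starRingEnd ℂ) (dft d c k) * dftKernel d k l =
      ∑ m, dftKernel d k l * (starRingEnd ℂ) (dftKernel d k m) * (starRingEnd ℂ) (c m) := by
    intro k
    rw [dft_eq_sum, map_sum, Finset.sum_mul]
    refine Finset.sum_congr rfl fun m _ => ?_
    rw [map_mul]; ring
  rw [Finset.sum_congr rfl fun k _ => this k, Finset.sum_comm]
  simp_rw [← Finset.sum_mul, sum_dftKernel_mul_conj hd]
  simp

lemma sum_norm_sq_dft {d : ℕ} (hd : d ≠ 0) (c : Fin d → ℂ) :
    ∑ k, ‖dft d c k‖ ^ 2 = ∑ l, ‖c l‖ ^ 2 := by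
  have h : ∑ k, (starRingEnd ℂ) (dft d c k) * dft d c k = ∑ l, (starRingEnd ℂ) (c l) * c l := by
    calc _ = ∑ k, ∑ l, (starRingEnd ℂ) (dft d c k) * dftKernel d k l * c l := by
          refine Finset.sum_congr rfl fun k _ => ?_
          nth_rw 2 [dft_eq_sum]
          simp only [Finset.mul_sum, mul_assoc]
      _ = _ := by
          rw [Finset.sum_comm]
          simp_rw [← Finset.sum_mul, sum_conj_dft_mul_dftKernel hd]
  simp_rw [Complex.conj_mul'] at h
  exact_mod_cast h

/-- The bilinear form of the Fourier kernel at the interpolated vectors, weighted so that its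
values on the strip `0 ≤ re z ≤ 1` have norm at most `1` when `c` is a unit vector. -/
noncomputable def interpForm (d : ℕ) (c : Fin d → ℂ) (z : ℂ) : ℂ :=
  Complex.exp (z * (Real.log d / 2)) * ∑ k, ∑ l,
    polarPow ((starRingEnd ℂ) (dft d c k)) (1 + z) * dftKernel d k l * polarPow (c l) (1 + z)

lemma exp_log_half {d : ℕ} (hd : d ≠ 0) : Real.exp (Real.log d / 2) = Real.sqrt d := by
  have : (0 : ℝ) < d := by positivity
  rw [Real.exp_half, Real.exp_log this]

lemma norm_exp_mul_log_half (d : ℕ) (z : ℂ) :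
    ‖Complex.exp (z * (Real.log d / 2))‖ = Real.exp (z.re * (Real.log d / 2)) := by
  have : z * (Real.log d / 2) = z * ((Real.log d / 2 : ℝ) : ℂ) := by push_cast; ring
  rw [Complex.norm_exp, this, Complex.re_mul_ofReal]

lemma norm_interpForm_le (d : ℕ) (c : Fin d → ℂ) (z : ℂ) :
    ‖interpForm d c z‖ ≤ Real.exp (z.re * (Real.log d / 2)) * ∑ k, ∑ l,
      ‖polarPow ((starRingEnd ℂ) (dft d c k)) (1 + z)‖ * (1 / Real.sqrt d) *
        ‖polarPow (c l) (1 + z)‖ := by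
  rw [interpForm, norm_mul, norm_exp_mul_log_half]
  gcongr
  refine (norm_sum_le _ _).trans (Finset.sum_le_sum fun k _ =>
    (norm_sum_le _ _).trans (Finset.sum_le_sum fun l _ => ?_))
  rw [norm_mul, norm_mul, norm_dftKernel]

lemma hasDerivAt_interpForm (d : ℕ) (c : Fin d → ℂ) (z : ℂ) :
    HasDerivAt (interpForm d c)
      (Complex.exp (z * (Real.log d / 2)) * (Real.log d / 2) * (∑ k, ∑ l,
        polarPow ((starRingEnd ℂ) (dft d c k)) (1 + z) * dftKernel d k l * polarPow (c l) (1 + z)) +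
      Complex.exp (z * (Real.log d / 2)) * ∑ k, ∑ l,
        (Real.log ‖dft d c k‖ + Real.log ‖c l‖) *
        (polarPow ((starRingEnd ℂ) (dft d c k)) (1 + z) * dftKernel d k l *
          polarPow (c l) (1 + z))) z := by
  have hexp : HasDerivAt (fun z : ℂ => Complex.exp (z * (Real.log d / 2)))
      (Complex.exp (z * (Real.log d / 2)) * (Real.log d / 2)) z := by
    simpa using ((hasDerivAt_id z).mul_const (Real.log d / 2 : ℂ)).cexp
  have hpow (a : ℂ) : HasDerivAt (fun z => polarPow a (1 + z))
      (Real.log ‖a‖ * polarPow a (1 + z)) z :=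
    (hasDerivAt_polarPow a (1 + z)).comp_const_add 1 z
  refine hexp.mul (HasDerivAt.fun_sum fun k _ => HasDerivAt.fun_sum fun l _ => ?_)
  refine (((hpow _).mul_const _).mul (hpow _)).congr_deriv ?_
  rw [RCLike.norm_conj]
  ring

lemma differentiable_interpForm (d : ℕ) (c : Fin d → ℂ) : Differentiable ℂ (interpForm d c) :=
  fun z => (hasDerivAt_interpForm d c z).differentiableAt

lemma norm_interpForm_le_one {d : ℕ} (hd : d ≠ 0) {c : Fin d → ℂ} (hc : ∑ l, ‖c l‖ ^ 2 = 1) {z : ℂ}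
    (hz : 0 ≤ z.re) (hz' : z.re ≤ 1) : ‖interpForm d c z‖ ≤ 1 := by
  have hc' : ∑ k, ‖dft d c k‖ ^ 2 = 1 := (sum_norm_sq_dft hd c).trans hc
  have hs : 0 < Real.sqrt d := Real.sqrt_pos.2 (by positivity)
  have hle {f : Fin d → ℂ} (hf : ∑ l, ‖f l‖ ^ 2 = 1) (l : Fin d) : ‖f l‖ ≤ 1 := by
    rw [← sq_le_one_iff₀ (norm_nonneg _), ← hf]
    exact Finset.single_le_sum (f := fun l => ‖f l‖ ^ 2) (fun _ _ => by positivity)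
      (Finset.mem_univ l)
  have key := Complex.HadamardThreeLines.norm_le_interp_of_mem_verticalClosedStrip₀₁'
    (interpForm d c) (z := z) (a := 1) (b := 1) ⟨hz, hz'⟩
    (differentiable_interpForm d c).diffContOnCl ?_ ?_ ?_
  · simpa using key
  · refine ⟨Real.exp (Real.log d / 2) * ∑ _k : Fin d, ∑ _l : Fin d, (1 / Real.sqrt d), ?_⟩
    rintro _ ⟨w, ⟨hw, hw'⟩, rfl⟩
    refine (norm_interpForm_le d c w).trans ?_
    have hw1 : 0 ≤ (1 + w).re := by simp only [Complex.add_re, Complex.one_re]; linarith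
    have hlog : 0 ≤ Real.log d / 2 := by have := Real.log_natCast_nonneg d; positivity
    gcongr with k _ l _
    · nlinarith
    · calc _ ≤ 1 * (1 / Real.sqrt d) * 1 := by
            gcongr
            · exact norm_polarPow_le_one (by rw [RCLike.norm_conj]; exact hle hc' k) hw1
            · exact norm_polarPow_le_one (hle hc l) hw1
        _ = _ := by ring
  · intro w (hw : w.re = 0)
    have hw1 : (1 + w).re = 1 := by simp [hw]
    let v : Fin d → ℂ := fun l => polarPow (c l) (1 + w)
    have hvn : ∑ k, ‖dft d v k‖ ^ 2 = 1 := by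
      rw [sum_norm_sq_dft hd, ← hc]
      simp only [v, norm_polarPow_of_re_eq_one _ hw1]
    have hform : interpForm d c w = Complex.exp (w * (Real.log d / 2)) *
        ∑ k, polarPow ((starRingEnd ℂ) (dft d c k)) (1 + w) * dft d v k := by
      have hdft (k) : dft d v k = ∑ l, dftKernel d k l * polarPow (c l) (1 + w) := dft_eq_sum d v k
      simp only [interpForm, hdft, Finset.mul_sum, mul_assoc]
    rw [hform, norm_mul, norm_exp_mul_log_half, hw, zero_mul, Real.exp_zero, one_mul]
    calc _ ≤ ∑ k, ‖dft d c k‖ * ‖dft d v k‖ := by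
          refine (norm_sum_le _ _).trans_eq (Finset.sum_congr rfl fun k _ => ?_)
          rw [norm_mul, norm_polarPow_of_re_eq_one _ hw1, RCLike.norm_conj]
      _ ≤ ∑ k, (‖dft d c k‖ ^ 2 + ‖dft d v k‖ ^ 2) / 2 :=
          Finset.sum_le_sum fun k _ => by nlinarith [two_mul_le_add_sq ‖dft d c k‖ ‖dft d v k‖]
      _ = 1 := by rw [← Finset.sum_div, Finset.sum_add_distrib, hc', hvn]; norm_num
  · intro w (hw : w.re = 1)
    have hw1 : (1 + w).re = 2 := by simp [hw]; norm_num
    refine (norm_interpForm_le d c w).trans_eq ?_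
    simp only [norm_polarPow_of_re_eq_two _ hw1, RCLike.norm_conj, hw, one_mul, exp_log_half hd,
      ← Finset.mul_sum, hc, mul_one, ← Finset.sum_mul, hc']
    field_simp

lemma interpForm_zero {d : ℕ} (hd : d ≠ 0) {c : Fin d → ℂ} (hc : ∑ l, ‖c l‖ ^ 2 = 1) :
    interpForm d c 0 = 1 := by
  simp only [interpForm, zero_mul, Complex.exp_zero, one_mul, add_zero, polarPow_one]
  rw [Finset.sum_comm]
  simp_rw [← Finset.sum_mul, sum_conj_dft_mul_dftKernel hd, Complex.conj_mul']
  exact_mod_cast hc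

lemma shannonEntropy_norm_sq (d : ℕ) (c : Fin d → ℂ) :
    shannonEntropy d (fun l => ‖c l‖ ^ 2) = -(2 * ∑ l, Real.log ‖c l‖ * ‖c l‖ ^ 2) := by
  rw [shannonEntropy, Finset.mul_sum]
  congr 1
  refine Finset.sum_congr rfl fun l _ => ?_
  rw [Real.log_pow]
  push_cast
  ring

lemma deriv_interpForm_zero {d : ℕ} (hd : d ≠ 0) {c : Fin d → ℂ} (hc : ∑ l, ‖c l‖ ^ 2 = 1) :
    deriv (interpForm d c) 0 = ((Real.log d - (shannonEntropy d (fun l => ‖c l‖ ^ 2) +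
      shannonEntropy d (fun k => ‖dft d c k‖ ^ 2))) / 2 : ℝ) := by
  have h1 := interpForm_zero hd hc
  have hA : ∑ k, ∑ l, (Real.log ‖dft d c k‖ : ℂ) *
      ((starRingEnd ℂ) (dft d c k) * dftKernel d k l * c l) =
      ((∑ k, Real.log ‖dft d c k‖ * ‖dft d c k‖ ^ 2 : ℝ) : ℂ) := by
    push_cast
    refine Finset.sum_congr rfl fun k _ => ?_
    simp only [mul_assoc]
    rw [← Finset.mul_sum, ← Finset.mul_sum, ← dft_eq_sum, Complex.conj_mul']
  have hB : ∑ k, ∑ l, (Real.log ‖c l‖ : ℂ) *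
      ((starRingEnd ℂ) (dft d c k) * dftKernel d k l * c l) =
      ((∑ l, Real.log ‖c l‖ * ‖c l‖ ^ 2 : ℝ) : ℂ) := by
    push_cast
    rw [Finset.sum_comm]
    refine Finset.sum_congr rfl fun l _ => ?_
    rw [← Finset.mul_sum, ← Complex.conj_mul', ← Finset.sum_mul, sum_conj_dft_mul_dftKernel hd]
  rw [(hasDerivAt_interpForm d c 0).deriv]
  simp only [interpForm, zero_mul, Complex.exp_zero, one_mul, add_zero, polarPow_one] at h1 ⊢
  simp only [h1, add_mul, Finset.sum_add_distrib, hA, hB, shannonEntropy_norm_sq]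
  push_cast
  ring

/-- Saturation of the entropic uncertainty relation aligns all the phases. -/
lemma sqrt_mul_conj_dft_mul_dftKernel_mul {d : ℕ} (hd : d ≠ 0) {c : Fin d → ℂ}
    (hc : ∑ l, ‖c l‖ ^ 2 = 1)
    (heq : shannonEntropy d (fun l => ‖c l‖ ^ 2) + shannonEntropy d (fun k => ‖dft d c k‖ ^ 2) =
      Real.log d) (k l : Fin d) :
    (Real.sqrt d : ℂ) * ((starRingEnd ℂ) (dft d c k) * dftKernel d k l * c l) =
      ((‖dft d c k‖ * ‖c l‖ : ℝ) : ℂ) := by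
  have hc' : ∑ k, ‖dft d c k‖ ^ 2 = 1 := (sum_norm_sq_dft hd c).trans hc
  have hs : 0 < Real.sqrt d := Real.sqrt_pos.2 (by positivity)
  have h1 : interpForm d c 1 = 1 :=
    eq_one_of_norm_le_one_of_deriv_eq_zero (differentiable_interpForm d c)
      (fun z => norm_interpForm_le_one hd hc) (interpForm_zero hd hc)
      (by rw [deriv_interpForm_zero hd hc, heq]; simp) 1
  set T : Fin d → Fin d → ℂ := fun k l =>
    (Real.sqrt d : ℂ) * ((starRingEnd ℂ) (dft d c k) * dftKernel d k l * c l) with hT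
  have hTn (k l) : ‖T k l‖ = ‖dft d c k‖ * ‖c l‖ := by
    simp only [hT, norm_mul, norm_dftKernel, RCLike.norm_conj, Complex.norm_real,
      Real.norm_of_nonneg hs.le]
    field_simp
  have hsum : ∑ k, ∑ l, ‖dft d c k‖ * ‖c l‖ * (T k l).re = 1 := by
    have hexp : Complex.exp (1 * (Real.log d / 2)) = (Real.sqrt d : ℂ) := by
      rw [← exp_log_half hd]; push_cast; rw [one_mul]
    have : ∑ k, ∑ l, ((‖dft d c k‖ * ‖c l‖ : ℝ) : ℂ) * T k l = 1 := by
      rw [← h1, interpForm, hexp, one_add_one_eq_two]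
      simp only [polarPow_two, Finset.mul_sum, RCLike.norm_conj, hT]
      refine Finset.sum_congr rfl fun k _ => Finset.sum_congr rfl fun l _ => ?_
      push_cast
      ring
    simpa only [Complex.re_sum, Complex.re_ofReal_mul, Complex.one_re] using congrArg Complex.re this
  have hsum' : ∑ k, ∑ l, ‖dft d c k‖ * ‖c l‖ * (‖dft d c k‖ * ‖c l‖) = 1 := by
    calc _ = ∑ k, ∑ l, ‖dft d c k‖ ^ 2 * ‖c l‖ ^ 2 :=
          Finset.sum_congr rfl fun k _ => Finset.sum_congr rfl fun l _ => by ring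
      _ = 1 := by simp only [← Finset.mul_sum, hc, mul_one, hc']
  have hle (k l) : ‖dft d c k‖ * ‖c l‖ * (T k l).re ≤
      ‖dft d c k‖ * ‖c l‖ * (‖dft d c k‖ * ‖c l‖) := by
    gcongr
    exact (Complex.re_le_norm _).trans_eq (hTn k l)
  have hk := (Finset.sum_eq_sum_iff_of_le fun k _ => Finset.sum_le_sum fun l _ => hle k l).1
    (hsum.trans hsum'.symm) k (Finset.mem_univ k)
  have hkl := (Finset.sum_eq_sum_iff_of_le fun l _ => hle k l).1 hk l (Finset.mem_univ l)
  change T k l = _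
  rcases eq_or_ne (‖dft d c k‖ * ‖c l‖) 0 with h0 | h0
  · rw [h0, Complex.ofReal_zero, ← norm_eq_zero, hTn, h0]
  · have hre : (T k l).re = ‖T k l‖ := (mul_left_cancel₀ h0 hkl).trans (hTn k l).symm
    rw [← hTn, ← hre]
    exact Complex.ext rfl (Complex.nonneg_iff.1 (Complex.re_eq_norm.1 hre)).2.symm

lemma card_support_mul_sq_eq_one {ι : Type*} [Fintype ι] {f : ι → ℂ} {a : ℝ}
    (hf : ∑ i, ‖f i‖ ^ 2 = 1) (ha : ∀ i, f i ≠ 0 → ‖f i‖ = a) :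
    ((Finset.univ.filter fun i => f i ≠ 0).card : ℝ) * a ^ 2 = 1 := by
  rw [← nsmul_eq_mul, ← Finset.sum_const, Finset.sum_filter, ← hf]
  refine Finset.sum_congr rfl fun i _ => ?_
  split_ifs with h
  · rw [ha i h]
  · simp [not_not.1 h]

/-- A unit vector saturating the entropic uncertainty relation has constant modulus on its support,
and its support size and that of its Fourier transform multiply to `d`. -/
lemma suppCard_mul_suppCard_dft_eq {d : ℕ} (hd : d ≠ 0) {c : Fin d → ℂ}
    (hc : ∑ l, ‖c l‖ ^ 2 = 1)
    (heq : shannonEntropy d (fun l => ‖c l‖ ^ 2) + shannonEntropy d (fun k => ‖dft d c k‖ ^ 2) =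
      Real.log d) :
    suppCard d c * suppCard d (dft d c) = d ∧
      ∀ l, c l ≠ 0 → (suppCard d c : ℝ) * ‖c l‖ ^ 2 = 1 := by
  have hc' : ∑ k, ‖dft d c k‖ ^ 2 = 1 := (sum_norm_sq_dft hd c).trans hc
  have hs : 0 < Real.sqrt d := Real.sqrt_pos.2 (by positivity)
  have halign := sqrt_mul_conj_dft_mul_dftKernel_mul hd hc heq
  set A := ∑ l, ‖c l‖ with hA
  set B := ∑ k, ‖dft d c k‖ with hB
  have hrow (k) : Real.sqrt d * ‖dft d c k‖ ^ 2 = ‖dft d c k‖ * A := by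
    have := Finset.sum_congr rfl fun l (_ : l ∈ Finset.univ) => halign k l
    simp only [mul_assoc] at this
    rw [← Finset.mul_sum, ← Finset.mul_sum, ← dft_eq_sum, Complex.conj_mul',
      ← Complex.ofReal_sum, ← Finset.mul_sum] at this
    exact_mod_cast this
  have hcol (l) : Real.sqrt d * ‖c l‖ ^ 2 = B * ‖c l‖ := by
    have := Finset.sum_congr rfl fun k (_ : k ∈ Finset.univ) => halign k l
    rw [← Finset.mul_sum, ← Finset.sum_mul, sum_conj_dft_mul_dftKernel hd, Complex.conj_mul',
      ← Complex.ofReal_sum, ← Finset.sum_mul] at this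
    exact_mod_cast this
  have hAB : Real.sqrt d = B * A := by
    have := Finset.sum_congr rfl fun k (_ : k ∈ Finset.univ) => hrow k
    rwa [← Finset.mul_sum, ← Finset.sum_mul, hc', mul_one] at this
  have hdft (k) (hk : dft d c k ≠ 0) : ‖dft d c k‖ = A / Real.sqrt d := by
    rw [eq_div_iff hs.ne']
    exact mul_left_cancel₀ (norm_ne_zero_iff.2 hk) (by linarith [hrow k])
  have hnorm (l) (hl : c l ≠ 0) : ‖c l‖ = B / Real.sqrt d := by
    rw [eq_div_iff hs.ne']
    exact mul_left_cancel₀ (norm_ne_zero_iff.2 hl) (by linarith [hcol l])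
  have hN : (suppCard d c : ℝ) * (B / Real.sqrt d) ^ 2 = 1 := card_support_mul_sq_eq_one hc hnorm
  have hM : (suppCard d (dft d c) : ℝ) * (A / Real.sqrt d) ^ 2 = 1 :=
    card_support_mul_sq_eq_one hc' hdft
  refine ⟨?_, fun l hl => by rw [hnorm l hl, hN]⟩
  have hinv : (B / Real.sqrt d) ^ 2 * (A / Real.sqrt d) ^ 2 = 1 / d := by
    have : (B / Real.sqrt d) ^ 2 * (A / Real.sqrt d) ^ 2 =
      (B * A) ^ 2 / (Real.sqrt d ^ 2 * Real.sqrt d ^ 2) := by ring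
    rw [this, ← hAB, Real.sq_sqrt (Nat.cast_nonneg d)]
    field_simp
  have hprod : (suppCard d c : ℝ) * suppCard d (dft d c) * (1 / d) = 1 := by
    rw [← hinv]
    linear_combination (suppCard d (dft d c) * (A / Real.sqrt d) ^ 2) * hN + hM
  have hd' : (d : ℝ) ≠ 0 := by exact_mod_cast hd
  field_simp at hprod
  exact_mod_cast hprod


theorem entropic_equality_prime_dim (d : ℕ) (hd : d.Prime) (c : Fin d → ℂ)
    (hc : ∑ l, ‖c l‖ ^ 2 = 1)
    (heq : shannonEntropy d (fun l => ‖c l‖ ^ 2)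
      + shannonEntropy d (fun k => ‖dft d c k‖ ^ 2) = Real.log d) :
    (suppCard d c = 1 ∨ suppCard d (dft d c) = 1) ∧
    ((∃ l₀ : Fin d, ∀ l, ‖c l‖ ^ 2 = if l = l₀ then 1 else 0) ∨
      (∀ l, ‖c l‖ ^ 2 = 1 / d)) := by
  obtain ⟨hmul, hflat⟩ := suppCard_mul_suppCard_dft_eq hd.ne_zero hc heq
  rcases (Nat.dvd_prime hd).1 (Dvd.intro _ hmul) with h1 | h1
  · refine ⟨Or.inl h1, Or.inl ?_⟩
    obtain ⟨l₀, hl₀⟩ := Finset.card_eq_one.1 h1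
    have hmem (l : Fin d) : c l ≠ 0 ↔ l = l₀ := by
      simpa using Finset.ext_iff.1 hl₀ l
    refine ⟨l₀, fun l => ?_⟩
    split_ifs with h
    · simpa [h1] using hflat l ((hmem l).2 h)
    · simp [not_not.1 (mt (hmem l).1 h)]
  · have hM : suppCard d (dft d c) = 1 := by
      rw [h1] at hmul
      exact Nat.eq_of_mul_eq_mul_left hd.pos (by rw [hmul, mul_one])
    refine ⟨Or.inr hM, Or.inr fun l => ?_⟩
    have hl : c l ≠ 0 := by
      have := Finset.card_filter_eq_iff.1 (h1.trans (Finset.card_fin d).symm)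
      exact this l (Finset.mem_univ l)
    have hd' : (d : ℝ) ≠ 0 := by exact_mod_cast hd.ne_zero
    rw [eq_div_iff hd', mul_comm, ← h1]
    exact hflat l hl
end
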